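/- arXiv:2112.02884 — 3 statements merged into one kernel-verified Lean document; each statement's English description precedes it below -/
import Mathlib

section
/- Equal leader-of-mediocre probabilities imply equal thresholds (Lemma 5): let r be an equilibrium threshold profile and let i, j be any two agents with p_i^lom = p_j^lom. Then r_i = r_j (and moreover neither of i, j leads the other). -/
open Finset

/-- `x` leads `y` (with requester `p`): `x ≠ y` and every walk from `p` to `y` contains `x`
in its support. -/
def Leads {V : Type*} (H : SimpleGraph V) (p x y : V) : Prop :=
  x ≠ y ∧ ∀ w : H.Walk p y, x ∈ w.support

variable {V : Type*} [Fintype V] [DecidableEq V]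

/-- The agents: all vertices other than the requester `p`. -/
def agents (p : V) : Finset V := Finset.univ.filter (· ≠ p)

/-- `Dset H p i`: the set of agents led by `i`. -/
noncomputable def Dset (H : SimpleGraph V) (p i : V) : Finset V :=
  @Finset.filter _ (fun j => Leads H p i j) (Classical.decPred _) (agents p)

/-- `Pset H p i`: the competitors of `i`, namely `U \ (D_i ∪ {i})`. -/
noncomputable def Pset (H : SimpleGraph V) (p i : V) : Finset V :=
  agents p \ insert i (Dset H p i)

/-- Agent `i`'s expected utility for contributing with ability `q`:
`π_i(q) = M * ∏_{j ∈ P_i} F (max (r j) q) - c`. -/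
noncomputable def piU (H : SimpleGraph V) (p : V) (c M : ℝ) (F : ℝ → ℝ)
    (r : V → ℝ) (i : V) (q : ℝ) : ℝ :=
  M * (∏ j ∈ Pset H p i, F (max (r j) q)) - c

/-- `r` is an equilibrium threshold profile: every threshold lies in `[l,u]`, every agent has
strictly positive utility for contributing with any ability strictly above her threshold, and
each threshold is either `l` or gives nonpositive utility. -/
def IsEqm (H : SimpleGraph V) (p : V) (l u c M : ℝ) (F : ℝ → ℝ) (r : V → ℝ) : Prop :=
  (∀ i ∈ agents p, r i ∈ Set.Icc l u) ∧
  (∀ i ∈ agents p, ∀ q ∈ Set.Ioc (r i) u, 0 < piU H p c M F r i q) ∧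
  (∀ i ∈ agents p, r i = l ∨ piU H p c M F r i (r i) ≤ 0)

/-- The leader-of-mediocre probability `p_i^lom = ∏_{k ∈ D_i} F (r k)`. -/
noncomputable def lom (H : SimpleGraph V) (p : V) (F : ℝ → ℝ) (r : V → ℝ) (i : V) : ℝ :=
  ∏ k ∈ Dset H p i, F (r k)

namespace Leads

variable {V : Type*} {H : SimpleGraph V} {p x y z : V}

theorem dist_lt (hreach : ∀ v : V, Nonempty (H.Walk p v)) (h : Leads H p x y) :
    H.dist p x < H.dist p y := by
  classical
  obtain ⟨w, hw⟩ := SimpleGraph.Reachable.exists_walk_length_eq_dist (hreach y)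
  rw [← hw]
  exact (SimpleGraph.dist_le _).trans_lt (w.length_takeUntil_lt_length (h.2 w) h.1)

theorem trans (hreach : ∀ v : V, Nonempty (H.Walk p v)) (hxy : Leads H p x y)
    (hyz : Leads H p y z) : Leads H p x z := by
  classical
  refine ⟨?_, fun w => w.support_takeUntil_subset_support (hyz.2 w) (hxy.2 _)⟩
  rintro rfl
  exact lt_asymm (hxy.dist_lt hreach) (hyz.dist_lt hreach)

theorem not_symm (hreach : ∀ v : V, Nonempty (H.Walk p v)) (h : Leads H p x y) :
    ¬ Leads H p y x :=
  fun h' => lt_asymm (h.dist_lt hreach) (h'.dist_lt hreach)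

end Leads

section Competitors

variable {H : SimpleGraph V} {p i j k : V}

theorem mem_Dset : k ∈ Dset H p i ↔ k ∈ agents p ∧ Leads H p i k := by
  simp [Dset]

theorem mem_Pset : k ∈ Pset H p i ↔ k ∈ agents p ∧ k ≠ i ∧ ¬ Leads H p i k := by
  simp only [Pset, mem_sdiff, mem_insert, mem_Dset]
  tauto

theorem Leads.Dset_subset (hreach : ∀ v : V, Nonempty (H.Walk p v)) (h : Leads H p i j) :
    Dset H p j ⊆ Dset H p i := by
  intro k hk
  rw [mem_Dset] at hk ⊢
  exact ⟨hk.1, h.trans hreach hk.2⟩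

theorem Leads.Pset_subset (hreach : ∀ v : V, Nonempty (H.Walk p v)) (h : Leads H p i j) :
    Pset H p i ⊆ Pset H p j := by
  intro k hk
  rw [mem_Pset] at hk ⊢
  exact ⟨hk.1, fun e => hk.2.2 (e ▸ h), fun h' => hk.2.2 (h.trans hreach h')⟩

theorem Leads.mem_Pset (hreach : ∀ v : V, Nonempty (H.Walk p v)) (h : Leads H p i j)
    (hi : i ∈ agents p) : i ∈ Pset H p j :=
  _root_.mem_Pset.2 ⟨hi, h.1, h.not_symm hreach⟩

theorem prod_Pset_mul (hi : i ∈ agents p) (g : V → ℝ) :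
    (∏ k ∈ Pset H p i, g k) * (g i * ∏ k ∈ Dset H p i, g k) = ∏ k ∈ agents p, g k := by
  have hni : i ∉ Dset H p i := fun h => (mem_Dset.1 h).2.1 rfl
  rw [← prod_insert hni, Pset]
  apply prod_sdiff
  intro k hk
  rcases mem_insert.1 hk with rfl | hk
  · exact hi
  · exact (mem_Dset.1 hk).1

end Competitors

theorem Finset.prod_le_prod_of_subset_of_mem_Icc {ι : Type*} {s t : Finset ι}
    (hst : s ⊆ t) {g : ι → ℝ} (hg : ∀ k ∈ t, g k ∈ Set.Icc (0 : ℝ) 1) :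
    ∏ k ∈ t, g k ≤ ∏ k ∈ s, g k :=
  prod_le_prod_of_subset_of_le_one hst (fun k hk => (hg k hk).1) fun k hk _ => (hg k hk).2

theorem StrictMonoOn.mem_Icc_zero_one {l u q : ℝ} {F : ℝ → ℝ}
    (hF : StrictMonoOn F (Set.Icc l u)) (hFl : F l = 0) (hFu : F u = 1) (hq : q ∈ Set.Icc l u) :
    F q ∈ Set.Icc (0 : ℝ) 1 := by
  have hlu := hq.1.trans hq.2
  exact ⟨hFl ▸ hF.monotoneOn (Set.left_mem_Icc.2 hlu) hq hq.1,
    hFu ▸ hF.monotoneOn hq (Set.right_mem_Icc.2 hlu) hq.2⟩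

namespace IsEqm

variable {H : SimpleGraph V} {p : V}
  {l u c M : ℝ} {F : ℝ → ℝ} {r : V → ℝ} {i j k : V}

theorem threshold_lt (heqm : IsEqm H p l u c M F r) (hlu : l < u) (hcM : c < M)
    (hFu : F u = 1) (hi : i ∈ agents p) : r i < u := by
  refine lt_of_le_of_ne (heqm.1 i hi).2 fun h => ?_
  rcases heqm.2.2 i hi with h' | h'
  · linarith
  · have hprod : ∏ k ∈ Pset H p i, F (max (r k) u) = 1 :=
      prod_eq_one fun k hk => by rw [max_eq_right (heqm.1 k (mem_Pset.1 hk).1).2, hFu]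
    rw [h, piU, hprod] at h'
    linarith

theorem max_mem (heqm : IsEqm H p l u c M F r) {q : ℝ} (hq : q ≤ u) (hk : k ∈ agents p) :
    max (r k) q ∈ Set.Icc l u :=
  ⟨(heqm.1 k hk).1.trans (le_max_left _ _), max_le (heqm.1 k hk).2 hq⟩

theorem piU_le_of_leads (heqm : IsEqm H p l u c M F r)
    (hreach : ∀ v : V, Nonempty (H.Walk p v)) (hM : 0 ≤ M)
    (hFmono : StrictMonoOn F (Set.Icc l u)) (hFl : F l = 0) (hFu : F u = 1)
    {q : ℝ} (hq : q ≤ u) (h : Leads H p i j) :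
    piU H p c M F r j q ≤ piU H p c M F r i q := by
  refine sub_le_sub_right (mul_le_mul_of_nonneg_left ?_ hM) c
  exact prod_le_prod_of_subset_of_mem_Icc (h.Pset_subset hreach) fun k hk =>
    hFmono.mem_Icc_zero_one hFl hFu (heqm.max_mem hq (mem_Pset.1 hk).1)

theorem threshold_le_of_leads (heqm : IsEqm H p l u c M F r)
    (hreach : ∀ v : V, Nonempty (H.Walk p v)) (hM : 0 ≤ M)
    (hFmono : StrictMonoOn F (Set.Icc l u)) (hFl : F l = 0) (hFu : F u = 1)
    (hi : i ∈ agents p) (hj : j ∈ agents p) (h : Leads H p i j) : r i ≤ r j := by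
  by_contra! hlt
  have hiu := (heqm.1 i hi).2
  have hpos := heqm.2.1 j hj (r i) ⟨hlt, hiu⟩
  have hle := heqm.piU_le_of_leads hreach hM hFmono hFl hFu hiu h
  rcases heqm.2.2 i hi with h' | h'
  · exact absurd (heqm.1 j hj).1 (by linarith)
  · linarith

theorem left_lt_threshold_of_leads (heqm : IsEqm H p l u c M F r)
    (hreach : ∀ v : V, Nonempty (H.Walk p v)) (hlu : l < u) (hc : 0 < c) (hcM : c < M)
    (hFcont : ContinuousOn F (Set.Icc l u)) (hFmono : StrictMonoOn F (Set.Icc l u))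
    (hFl : F l = 0) (hFu : F u = 1)
    (hi : i ∈ agents p) (hj : j ∈ agents p) (h : Leads H p i j) : l < r j := by
  have hM : 0 < M := hc.trans hcM
  refine lt_of_le_of_ne (heqm.1 j hj).1 fun hlj => ?_
  have hil : r i = l := le_antisymm
    (hlj ▸ heqm.threshold_le_of_leads hreach hM.le hFmono hFl hFu hi hj h) (heqm.1 i hi).1
  have hcM0 : 0 < c / M := div_pos hc hM
  obtain ⟨q, hq, hFq⟩ : c / M ∈ F '' Set.Icc l u :=
    intermediate_value_Icc hlu.le hFcont (by
      rw [hFl, hFu]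
      exact ⟨hcM0.le, (div_le_one hM).2 hcM.le⟩)
  have hlq : l < q := lt_of_le_of_ne hq.1 fun e => by
    rw [← e, hFl] at hFq
    exact hcM0.ne hFq
  have hpos := heqm.2.1 j hj q ⟨hlj ▸ hlq, hq.2⟩
  have hle : ∏ k ∈ Pset H p j, F (max (r k) q) ≤ ∏ k ∈ {i}, F (max (r k) q) :=
    prod_le_prod_of_subset_of_mem_Icc (singleton_subset_iff.2 (h.mem_Pset hreach hi))
      fun k hk => hFmono.mem_Icc_zero_one hFl hFu (heqm.max_mem hq.2 (mem_Pset.1 hk).1)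
  rw [prod_singleton, hil, max_eq_right hq.1, hFq] at hle
  have hMle := mul_le_mul_of_nonneg_left hle hM.le
  rw [mul_div_cancel₀ c hM.ne'] at hMle
  rw [piU] at hpos
  linarith

theorem lom_pos (heqm : IsEqm H p l u c M F r)
    (hreach : ∀ v : V, Nonempty (H.Walk p v)) (hlu : l < u) (hc : 0 < c) (hcM : c < M)
    (hFcont : ContinuousOn F (Set.Icc l u)) (hFmono : StrictMonoOn F (Set.Icc l u))
    (hFl : F l = 0) (hFu : F u = 1) (hi : i ∈ agents p) : 0 < lom H p F r i := by
  refine prod_pos fun k hk => ?_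
  obtain ⟨hk, hik⟩ := mem_Dset.1 hk
  rw [← hFl]
  exact hFmono (Set.left_mem_Icc.2 hlu.le) (heqm.1 k hk)
    (heqm.left_lt_threshold_of_leads hreach hlu hc hcM hFcont hFmono hFl hFu hi hk hik)

theorem lom_lt_of_leads (heqm : IsEqm H p l u c M F r)
    (hreach : ∀ v : V, Nonempty (H.Walk p v)) (hlu : l < u) (hc : 0 < c) (hcM : c < M)
    (hFcont : ContinuousOn F (Set.Icc l u)) (hFmono : StrictMonoOn F (Set.Icc l u))
    (hFl : F l = 0) (hFu : F u = 1) (hj : j ∈ agents p)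
    (h : Leads H p i j) : lom H p F r i < lom H p F r j := by
  have hnj : j ∉ Dset H p j := fun hmem => (mem_Dset.1 hmem).2.1 rfl
  have hle : lom H p F r i ≤ ∏ k ∈ insert j (Dset H p j), F (r k) := by
    refine prod_le_prod_of_subset_of_mem_Icc
      (insert_subset (mem_Dset.2 ⟨hj, h⟩) (h.Dset_subset hreach)) fun k hk => ?_
    exact hFmono.mem_Icc_zero_one hFl hFu (heqm.1 k (mem_Dset.1 hk).1)
  rw [prod_insert hnj] at hle
  refine hle.trans_lt (mul_lt_of_lt_one_left ?_ ?_)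
  · exact heqm.lom_pos hreach hlu hc hcM hFcont hFmono hFl hFu hj
  · rw [← hFu]
    exact hFmono (heqm.1 j hj) (Set.right_mem_Icc.2 hlu.le)
      (heqm.threshold_lt hlu hcM hFu hj)

theorem threshold_le_of_lom_eq (heqm : IsEqm H p l u c M F r)
    (hreach : ∀ v : V, Nonempty (H.Walk p v)) (hlu : l < u) (hc : 0 < c) (hcM : c < M)
    (hFcont : ContinuousOn F (Set.Icc l u)) (hFmono : StrictMonoOn F (Set.Icc l u))
    (hFl : F l = 0) (hFu : F u = 1) (hi : i ∈ agents p) (hj : j ∈ agents p)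
    (hlom : lom H p F r i = lom H p F r j) : r j ≤ r i := by
  by_contra! hlt
  have hM : 0 < M := hc.trans hcM
  have hrj := heqm.1 j hj
  have hlj : l < r j := (heqm.1 i hi).1.trans_lt hlt
  have hFj : 0 < F (r j) := hFl ▸ hFmono (Set.left_mem_Icc.2 hlu.le) hrj hlj
  have hposi := heqm.2.1 i hi (r j) ⟨hlt, hrj.2⟩
  have hnonposj := (heqm.2.2 j hj).resolve_left hlj.ne'
  have hlompos := heqm.lom_pos hreach hlu hc hcM hFcont hFmono hFl hFu hj
  have hDj : ∏ k ∈ Dset H p j, F (max (r k) (r j)) = lom H p F r j := by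
    refine prod_congr rfl fun k hk => ?_
    obtain ⟨hk, hjk⟩ := mem_Dset.1 hk
    rw [max_eq_left (heqm.threshold_le_of_leads hreach hM.le hFmono hFl hFu hj hk hjk)]
  have hDi : lom H p F r i ≤ ∏ k ∈ Dset H p i, F (max (r k) (r j)) := by
    refine prod_le_prod (fun k hk => ?_) fun k hk => ?_
    · exact (hFmono.mem_Icc_zero_one hFl hFu (heqm.1 k (mem_Dset.1 hk).1)).1
    · exact hFmono.monotoneOn (heqm.1 k (mem_Dset.1 hk).1)
        (heqm.max_mem hrj.2 (mem_Dset.1 hk).1) (le_max_left _ _)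
  have hprod := (prod_Pset_mul (H := H) hi fun k => F (max (r k) (r j))).trans
    (prod_Pset_mul (H := H) hj fun k => F (max (r k) (r j))).symm
  simp only [max_eq_right hlt.le, max_self, hDj] at hprod
  rw [hlom] at hDi
  rw [piU] at hposi hnonposj
  have hPlt : ∏ k ∈ Pset H p j, F (max (r k) (r j)) < ∏ k ∈ Pset H p i, F (max (r k) (r j)) :=
    lt_of_mul_lt_mul_left (by linarith) hM.le
  have hPi : 0 < ∏ k ∈ Pset H p i, F (max (r k) (r j)) :=
    pos_of_mul_pos_right (by linarith) hM.le
  exact (mul_lt_mul hPlt (mul_le_mul_of_nonneg_left hDi hFj.le)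
    (mul_pos hFj hlompos) hPi.le).ne' hprod

end IsEqm

/-- Equal leader-of-mediocre probabilities imply equal thresholds (Lemma 5); moreover
neither agent leads the other. -/
theorem lom_eq_imp_threshold_eq {V : Type*} [Fintype V] [DecidableEq V]
    (H : SimpleGraph V) (p : V) (hreach : ∀ v : V, Nonempty (H.Walk p v))
    (l u c M : ℝ) (hlu : l < u) (hc : 0 < c) (hcM : c < M)
    (F : ℝ → ℝ) (hFcont : ContinuousOn F (Set.Icc l u))
    (hFmono : StrictMonoOn F (Set.Icc l u)) (hFl : F l = 0) (hFu : F u = 1)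
    (r : V → ℝ) (heqm : IsEqm H p l u c M F r)
    (i j : V) (hi : i ∈ agents p) (hj : j ∈ agents p)
    (hlom : lom H p F r i = lom H p F r j) :
    r i = r j ∧ ¬ Leads H p i j ∧ ¬ Leads H p j i := by
  refine ⟨le_antisymm ?_ ?_, fun h => ?_, fun h => ?_⟩
  · exact heqm.threshold_le_of_lom_eq hreach hlu hc hcM hFcont hFmono hFl hFu hj hi hlom.symm
  · exact heqm.threshold_le_of_lom_eq hreach hlu hc hcM hFcont hFmono hFl hFu hi hj hlom
  · exact (heqm.lom_lt_of_leads hreach hlu hc hcM hFcont hFmono hFl hFu hj h).ne hlom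
  · exact (heqm.lom_lt_of_leads hreach hlu hc hcM hFcont hFmono hFl hFu hi h).ne' hlom
end

section
/- Contribution threshold formula (Theorem 4, Eq. (5)): let r be an equilibrium threshold profile and let i be an agent with r_i > l. Let J_i = {j ∈ P_i : r_j > r_i} and Q_i = {j ∈ P_i : r_j ≤ r_i}. Then M · (∏_{j ∈ J_i} F(r_j)) · F(r_i)^{|Q_i|} = c; equivalently, F(r_i)^{|Q_i|} = (c/M) / ∏_{j ∈ J_i} F(r_j). -/
open Finset

variable {V : Type*} [Fintype V] [DecidableEq V]

theorem Pset_subset_agents (H : SimpleGraph V) (p i : V) : Pset H p i ⊆ agents p :=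
  sdiff_subset

theorem continuousOn_piU (H : SimpleGraph V) (p : V) {l u : ℝ} (c M : ℝ) {F : ℝ → ℝ}
    (hF : ContinuousOn F (Set.Icc l u)) {r : V → ℝ} (hr : ∀ j ∈ agents p, r j ∈ Set.Icc l u)
    (i : V) : ContinuousOn (piU H p c M F r i) (Set.Icc l u) := by
  refine (continuousOn_const.mul (continuousOn_finsetProd _ fun j hj => ?_)).sub
    continuousOn_const
  have hj := hr j (Pset_subset_agents H p i hj)
  exact hF.comp (by fun_prop) fun q hq => ⟨le_max_of_le_left hj.1, max_le hj.2 hq.2⟩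

/-- The utility at the own threshold, with the competitors split by whether their threshold is
higher. -/
theorem piU_threshold (H : SimpleGraph V) (p : V) (c M : ℝ) (F : ℝ → ℝ) (r : V → ℝ) (i : V) :
    piU H p c M F r i (r i) =
      M * (∏ j ∈ (Pset H p i).filter (fun j => r i < r j), F (r j)) *
        F (r i) ^ ((Pset H p i).filter (fun j => r j ≤ r i)).card - c := by
  have h₁ : ∏ j ∈ (Pset H p i).filter (fun j => r i < r j), F (max (r j) (r i)) =
      ∏ j ∈ (Pset H p i).filter (fun j => r i < r j), F (r j) :=
    prod_congr rfl fun j hj => by rw [max_eq_left (mem_filter.1 hj).2.le]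
  have h₂ : ∏ j ∈ (Pset H p i).filter (fun j => r j ≤ r i), F (max (r j) (r i)) =
      F (r i) ^ ((Pset H p i).filter (fun j => r j ≤ r i)).card :=
    prod_eq_pow_card fun j hj => by rw [max_eq_right (mem_filter.1 hj).2]
  rw [piU, ← prod_filter_mul_prod_filter_not (Pset H p i) (fun j => r i < r j), h₁]
  simp only [not_lt]
  rw [h₂, mul_assoc]

/-- At the top ability `u` an agent wins for sure. -/
theorem piU_top (H : SimpleGraph V) (p : V) {l u : ℝ} (c M : ℝ) {F : ℝ → ℝ} (hFu : F u = 1)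
    {r : V → ℝ} (hr : ∀ j ∈ agents p, r j ∈ Set.Icc l u) (i : V) :
    piU H p c M F r i u = M - c := by
  rw [piU, prod_eq_one fun j hj => ?_, mul_one]
  rw [max_eq_right (hr j (Pset_subset_agents H p i hj)).2, hFu]

/-- An agent whose equilibrium threshold exceeds `l` is indifferent at that threshold. -/
theorem IsEqm.piU_threshold_eq_zero {H : SimpleGraph V} {p : V} {l u c M : ℝ} (hcM : c < M)
    {F : ℝ → ℝ} (hF : ContinuousOn F (Set.Icc l u)) (hFu : F u = 1) {r : V → ℝ}
    (heqm : IsEqm H p l u c M F r) {i : V} (hi : i ∈ agents p) (hri : l < r i) :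
    piU H p c M F r i (r i) = 0 := by
  obtain ⟨hr, hpos, hthr⟩ := heqm
  have hle : piU H p c M F r i (r i) ≤ 0 := (hthr i hi).resolve_left hri.ne'
  have hlt : r i < u := by
    refine (hr i hi).2.lt_of_ne fun h => ?_
    rw [h, piU_top H p c M hFu hr i] at hle
    linarith
  refine le_antisymm hle ?_
  have hcont : ContinuousWithinAt (piU H p c M F r i) (Set.Ioc (r i) u) (r i) :=
    (continuousOn_piU H p c M hF hr i (r i) (hr i hi)).mono
      fun q hq => ⟨(hri.trans hq.1).le, hq.2⟩
  rw [ContinuousWithinAt, nhdsWithin_Ioc_eq_nhdsGT hlt] at hcont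
  refine ge_of_tendsto hcont ?_
  filter_upwards [Ioc_mem_nhdsGT hlt] with q hq using (hpos i hi q hq).le

/-- Contribution threshold formula (Theorem 4, Eq. (5)): for an agent with `r i > l`,
`M * (∏ j ∈ J_i, F (r j)) * F (r i) ^ |Q_i| = c`, where `J_i` are the competitors with
threshold above `r i` and `Q_i` those with threshold at most `r i`. -/
theorem contribution_threshold_formula {V : Type*} [Fintype V] [DecidableEq V]
    (H : SimpleGraph V) (p : V) (hreach : ∀ v : V, Nonempty (H.Walk p v))
    (l u c M : ℝ) (hlu : l < u) (hc : 0 < c) (hcM : c < M)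
    (F : ℝ → ℝ) (hFcont : ContinuousOn F (Set.Icc l u))
    (hFmono : StrictMonoOn F (Set.Icc l u)) (hFl : F l = 0) (hFu : F u = 1)
    (r : V → ℝ) (heqm : IsEqm H p l u c M F r)
    (i : V) (hi : i ∈ agents p) (hri : l < r i) :
    M * (∏ j ∈ (Pset H p i).filter (fun j => r i < r j), F (r j)) *
      F (r i) ^ ((Pset H p i).filter (fun j => r j ≤ r i)).card = c := by
  have h := heqm.piU_threshold_eq_zero hcM hFcont hFu hi hri
  rw [piU_threshold] at h
  exact sub_eq_zero.1 h
end

section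
/- Multiple minimum thresholds lie strictly above the lower bound (Lemma on minimum thresholds, part 2): let r be an equilibrium threshold profile, and suppose there exist two distinct agents i ≠ j that both attain the minimum threshold, i.e., r_i = r_j ≤ r_k for every agent k. Then r_i > l; in particular, in this case there is no unconditional contributor. -/
open Finset

variable {V : Type*} [Fintype V] [DecidableEq V]

/-- The relation `Leads` is asymmetric as soon as one of the vertices is reachable: on a path
to `y` through `x`, the segment up to `x` avoids `y`. -/
theorem Leads.asymm {V : Type*} {H : SimpleGraph V} {p x y : V} (hy : Nonempty (H.Walk p y))
    (hxy : Leads H p x y) : ¬ Leads H p y x := by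
  classical
  intro hyx
  obtain ⟨w⟩ := hy
  exact SimpleGraph.Walk.endpoint_notMem_support_takeUntil w.bypass_isPath (hxy.2 w.bypass)
    hxy.1.symm (hyx.2 _)

theorem mem_Pset_s15 {V : Type*} [Fintype V] [DecidableEq V] {H : SimpleGraph V} {p i j : V}
    (hj : j ∈ agents p) (hij : i ≠ j) (h : ¬ Leads H p i j) : j ∈ Pset H p i := by
  simp [Pset, Dset, hj, hij.symm, h]

/-- In equilibrium, an agent with threshold `l` has no competitor with threshold `l`. -/
theorem IsEqm.notMem_Pset_of_eq_lower {V : Type*} [Fintype V] [DecidableEq V]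
    {H : SimpleGraph V} {p : V} {l u c M : ℝ} (hlu : l < u) (hc : 0 < c) (hcM : c < M)
    {F : ℝ → ℝ} (hFcont : ContinuousOn F (Set.Icc l u))
    (hFmono : StrictMonoOn F (Set.Icc l u)) (hFl : F l = 0) (hFu : F u = 1)
    {r : V → ℝ} (heqm : IsEqm H p l u c M F r) {i j : V} (hi : i ∈ agents p)
    (hri : r i = l) (hrj : r j = l) : j ∉ Pset H p i := by
  intro hjP
  have hM : 0 < M := hc.trans hcM
  obtain ⟨q, hq, hFq⟩ : c / M ∈ F '' Set.Ioo l u := by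
    refine intermediate_value_Ioo hlu.le hFcont ?_
    rw [hFl, hFu]
    exact ⟨by positivity, (div_lt_one hM).2 hcM⟩
  have hF : ∀ x ∈ Set.Icc l u, 0 ≤ F x ∧ F x ≤ 1 := fun x hx =>
    ⟨hFl ▸ hFmono.monotoneOn (Set.left_mem_Icc.2 hlu.le) hx hx.1,
      hFu ▸ hFmono.monotoneOn hx (Set.right_mem_Icc.2 hlu.le) hx.2⟩
  have hmax : ∀ k ∈ Pset H p i, max (r k) q ∈ Set.Icc l u := fun k hk =>
    ⟨hq.1.le.trans (le_max_right _ _),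
      max_le (heqm.1 k (Finset.mem_sdiff.1 hk).1).2 hq.2.le⟩
  have hprod : ∏ k ∈ Pset H p i, F (max (r k) q) ≤ c / M := by
    rw [← Finset.mul_prod_erase _ _ hjP, hrj, max_eq_right hq.1.le, hFq]
    refine mul_le_of_le_one_right (by positivity) (Finset.prod_le_one ?_ ?_) <;> intro k hk
    · exact (hF _ (hmax k (Finset.mem_of_mem_erase hk))).1
    · exact (hF _ (hmax k (Finset.mem_of_mem_erase hk))).2
  have hpos := heqm.2.1 i hi q ⟨hri ▸ hq.1, hq.2.le⟩
  rw [le_div_iff₀ hM] at hprod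
  unfold piU at hpos
  linarith

/-- Multiple minimum thresholds lie strictly above the lower bound: if two distinct agents
both attain the minimum threshold, then the minimum threshold is strictly above `l`. -/
theorem multiple_min_threshold_gt_lower_bound {V : Type*} [Fintype V] [DecidableEq V]
    (H : SimpleGraph V) (p : V) (hreach : ∀ v : V, Nonempty (H.Walk p v))
    (l u c M : ℝ) (hlu : l < u) (hc : 0 < c) (hcM : c < M)
    (F : ℝ → ℝ) (hFcont : ContinuousOn F (Set.Icc l u))
    (hFmono : StrictMonoOn F (Set.Icc l u)) (hFl : F l = 0) (hFu : F u = 1)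
    (r : V → ℝ) (heqm : IsEqm H p l u c M F r)
    (i j : V) (hi : i ∈ agents p) (hj : j ∈ agents p) (hij : i ≠ j)
    (hrij : r i = r j) (hmin : ∀ k ∈ agents p, r i ≤ r k) :
    l < r i := by
  by_contra hlt
  have hri : r i = l := le_antisymm (not_lt.1 hlt) (heqm.1 i hi).1
  have hrj : r j = l := hrij ▸ hri
  by_cases h : Leads H p i j
  · exact heqm.notMem_Pset_of_eq_lower hlu hc hcM hFcont hFmono hFl hFu hj hrj hri
      (mem_Pset_s15 hi hij.symm (h.asymm (hreach j)))
  · exact heqm.notMem_Pset_of_eq_lower hlu hc hcM hFcont hFmono hFl hFu hi hri hrj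
      (mem_Pset_s15 hj hij h)
end
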